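/- Fix n ≥ 1 and 1 ≤ k ≤ n. For every k-form ω on V = ℝ^{1+n}, the energy tensor of the (1+n−k)-form *ω equals the energy tensor of ω: for all D₁, D₂ ∈ V, (−1)^{(1+n−k)−1}( ⟨i_{D₁}(*ω), i_{D₂}(*ω)⟩ − (1/2)⟨*ω, *ω⟩ η(D₁,D₂) ) = (−1)^{k−1}( ⟨i_{D₁}ω, i_{D₂}ω⟩ − (1/2)⟨ω, ω⟩ η(D₁,D₂) ). -/

import Mathlib

namespace Paper

noncomputable section

/-- The vector space `V = ℝ^{1+n}`. -/
abbrev V (n : ℕ) := Fin (n + 1) → ℝ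

/-- The standard basis vectors `e₀, …, e_n`. -/
def eb (n : ℕ) (i : Fin (n + 1)) : V n := Pi.single i 1

/-- The signs `ε₀ = 1`, `ε_i = -1` for `i ≠ 0`. -/
def eps (n : ℕ) (i : Fin (n + 1)) : ℝ := if i = 0 then 1 else -1

/-- The Minkowski bilinear form `η(x,y) = x₀y₀ − Σᵢ xᵢyᵢ`. -/
def mink (n : ℕ) (x y : V n) : ℝ := ∑ i, eps n i * x i * y i

/-- An observer: a unitary timelike vector oriented to the future. -/
def IsObserver (n : ℕ) (U : V n) : Prop := mink n U U = 1 ∧ 0 < mink n U (eb n 0)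

open Classical in
/-- The induced scalar product of two (raw) `k`-forms:
`⟨ω, ω̄⟩ = Σ_{i₁ < ⋯ < i_k} ε_{i₁}⋯ε_{i_k} ω(e_{i₁},…,e_{i_k}) ω̄(e_{i₁},…,e_{i_k})`. -/
def finner (n k : ℕ) (ω ω' : (Fin k → V n) → ℝ) : ℝ :=
  ∑ v ∈ Finset.univ.filter (fun v : Fin k → Fin (n + 1) => StrictMono v),
    (∏ j, eps n (v j)) * ω (fun j => eb n (v j)) * ω' (fun j => eb n (v j))

/-- Interior product `i_D ω = ω(D, −, …, −)` of a vector with a (raw) `k`-form. -/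
def inter (n k : ℕ) (D : V n) (ω : (Fin k → V n) → ℝ) : (Fin (k - 1) → V n) → ℝ :=
  fun v => ω (fun j => if h : (j : ℕ) = 0 then D
    else v ⟨(j : ℕ) - 1, by have := j.isLt; omega⟩)

/-- The metrically equivalent `1`-form `U* = η(U, −)`. -/
def ustar (n : ℕ) (U : V n) : V n → ℝ := fun w => mink n U w

/-- Wedge product of a `1`-form with a (raw) `k`-form:
`(α ∧ ω)(v₀,…,v_k) = Σ_j (−1)^j α(v_j) ω(v₀,…,v̂_j,…,v_k)`. -/
def wedge1 (n k : ℕ) (α : V n → ℝ) (ω : (Fin k → V n) → ℝ) : (Fin (k + 1) → V n) → ℝ :=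
  fun v => ∑ j : Fin (k + 1), (-1 : ℝ) ^ (j : ℕ) * α (v j) * ω (v ∘ j.succAbove)

/-- The electric part `E_U = U* ∧ i_U ω` of a `k`-form with respect to an observer `U`. -/
def EU (n k : ℕ) (U : V n) (ω : (Fin k → V n) → ℝ) : (Fin (k - 1 + 1) → V n) → ℝ :=
  wedge1 n (k - 1) (ustar n U) (inter n k U ω)

/-- The magnetic part `B_U = i_U (U* ∧ ω)` of a `k`-form with respect to an observer `U`. -/
def BU (n k : ℕ) (U : V n) (ω : (Fin k → V n) → ℝ) : (Fin k → V n) → ℝ :=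
  inter n (k + 1) U (wedge1 n k (ustar n U) ω)

/-- Reindexing a raw form along an equality of degrees. -/
def reind (n : ℕ) {m m' : ℕ} (h : m = m') (ω : (Fin m → V n) → ℝ) : (Fin m' → V n) → ℝ :=
  fun v => ω (fun j => v (Fin.cast h j))

/-- The energy tensor of a `k`-form:
`(−1)^{k−1} T(D₁,D₂) = ⟨i_{D₁}ω, i_{D₂}ω⟩ − (1/2)⟨ω,ω⟩ η(D₁,D₂)`. -/
def energyT (n k : ℕ) (ω : (Fin k → V n) → ℝ) (D₁ D₂ : V n) : ℝ :=
  (-1 : ℝ) ^ (k - 1) * (finner n (k - 1) (inter n k D₁ ω) (inter n k D₂ ω)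
    - (1 / 2) * finner n k ω ω * mink n D₁ D₂)

/-- The volume form `dX`, with `dX(e₀,…,e_n) = 1`. -/
def dX (n : ℕ) (u : Fin (n + 1) → V n) : ℝ := Matrix.det (Matrix.of fun i j => u i j)

/-- The Hodge star of a (raw) `k`-form:
`(*ω)(v₁,…,v_{1+n−k}) = (1/k!) Σ_{i₁,…,i_k} ε_{i₁}⋯ε_{i_k} ω(e_{i₁},…,e_{i_k})
  dX(e_{i₁},…,e_{i_k},v₁,…,v_{1+n−k})`. -/
def hodge (n k : ℕ) (ω : (Fin k → V n) → ℝ) : (Fin (n + 1 - k) → V n) → ℝ :=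
  fun v => (1 / (k.factorial : ℝ)) * ∑ i : Fin k → Fin (n + 1),
    (∏ j, eps n (i j)) * ω (fun j => eb n (i j)) *
      dX n (fun l => if h : (l : ℕ) < k then eb n (i ⟨(l : ℕ), h⟩)
        else v ⟨(l : ℕ) - k, by have := l.isLt; omega⟩)

/-- The bilinear form associated to a matrix `g`. -/
def gbil (n : ℕ) (g : Matrix (Fin (n + 1)) (Fin (n + 1)) ℝ) (x y : V n) : ℝ :=
  ∑ a, ∑ b, g a b * x a * y b

/-- The scalar product of two (raw) `k`-forms with respect to a metric `g` (indices raised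
with the inverse matrix `g⁻¹`):
`⟨ω,ω̄⟩_g = (1/k!) Σ g^{i₁j₁}⋯g^{i_kj_k} ω_{i₁…i_k} ω̄_{j₁…j_k}`. -/
def ginner (n : ℕ) (g : Matrix (Fin (n + 1)) (Fin (n + 1)) ℝ) (k : ℕ)
    (ω ω' : (Fin k → V n) → ℝ) : ℝ :=
  (1 / (k.factorial : ℝ)) * ∑ v : Fin k → Fin (n + 1), ∑ w : Fin k → Fin (n + 1),
    (∏ j, g⁻¹ (v j) (w j)) * ω (fun j => eb n (v j)) * ω' (fun j => eb n (w j))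

/-- The energy tensor of a `k`-form with respect to a metric `g`:
`T(g,ω)(D₁,D₂) = (−1)^{k−1}( ⟨i_{D₁}ω, i_{D₂}ω⟩_g − (1/2)⟨ω,ω⟩_g g(D₁,D₂) )`. -/
def energyTg (n : ℕ) (g : Matrix (Fin (n + 1)) (Fin (n + 1)) ℝ) (k : ℕ)
    (ω : (Fin k → V n) → ℝ) (D₁ D₂ : V n) : ℝ :=
  (-1 : ℝ) ^ (k - 1) * (ginner n g (k - 1) (inter n k D₁ ω) (inter n k D₂ ω)
    - (1 / 2) * ginner n g k ω ω * gbil n g D₁ D₂)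

end

end Paper

namespace Paper

open Finset

/-- Tensors of degree `k` given by their components in the standard basis. -/
abbrev Comp (n k : ℕ) := (Fin k → Fin (n + 1)) → ℝ

/-- Antisymmetry of a component tensor. -/
def IsAnti {n k : ℕ} (f : Comp n k) : Prop :=
  ∀ (v : Fin k → Fin (n + 1)) (τ : Equiv.Perm (Fin k)),
    f (v ∘ τ) = ((Equiv.Perm.sign τ : ℤ) : ℝ) * f v

/-- The product of signs along a multi-index. -/
noncomputable def epsProd (n : ℕ) {k : ℕ} (v : Fin k → Fin (n + 1)) : ℝ := ∏ j, eps n (v j)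

/-- The scalar product of component tensors, summed over all multi-indices. -/
noncomputable def fullInner {n k : ℕ} (f g : Comp n k) : ℝ := ∑ v, epsProd n v * f v * g v

/-- Contraction of a component tensor with a vector in the first slot. -/
noncomputable def contract {n k : ℕ} (D : V n) (f : Comp n (k + 1)) : Comp n k :=
  fun v => ∑ x, D x * f (Fin.cons x v)

/-- Exterior product of the covector dual to `D` with a component tensor. -/
noncomputable def wedgeComp {n k : ℕ} (D : V n) (f : Comp n k) : Comp n (k + 1) :=
  fun v => ∑ j : Fin (k + 1), (-1 : ℝ) ^ (j : ℕ) * (eps n (v j) * D (v j)) * f (j.removeNth v)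

/-- The Levi-Civita symbol. -/
noncomputable def levi (n : ℕ) (g : Fin (n + 1) → Fin (n + 1)) : ℝ := dX n fun l => eb n (g l)

/-- The multi-index obtained by gluing two multi-indices along an equivalence. -/
def glue {n k m : ℕ} (e : Fin k ⊕ Fin m ≃ Fin (n + 1)) (i : Fin k → Fin (n + 1))
    (w : Fin m → Fin (n + 1)) : Fin (n + 1) → Fin (n + 1) := Sum.elim i w ∘ e.symm

/-- The Hodge star on component tensors. -/
noncomputable def starComp {n k m : ℕ} (e : Fin k ⊕ Fin m ≃ Fin (n + 1)) (f : Comp n k) :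
    Comp n m :=
  fun w => (1 / (k.factorial : ℝ)) * ∑ i, epsProd n i * f i * levi n (glue e i w)

section Signs

lemma eps_mul_self (n : ℕ) (i : Fin (n + 1)) : eps n i * eps n i = 1 := by
  unfold eps; split_ifs <;> norm_num

lemma epsProd_comp_perm {n k : ℕ} (v : Fin k → Fin (n + 1)) (τ : Equiv.Perm (Fin k)) :
    epsProd n (v ∘ τ) = epsProd n v :=
  Equiv.prod_comp τ fun j => eps n (v j)

lemma epsProd_insertNth {n k : ℕ} (j : Fin (k + 1)) (x : Fin (n + 1)) (v : Fin k → Fin (n + 1)) :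
    epsProd n (j.insertNth x v : Fin (k + 1) → Fin (n + 1)) = eps n x * epsProd n v := by
  simp [epsProd, Fin.prod_univ_succAbove _ j]

lemma prod_eps (n : ℕ) : ∏ i, eps n i = (-1 : ℝ) ^ n := by
  simp [Fin.prod_univ_succ, eps, Fin.succ_ne_zero]

lemma sign_mul_self {ι : Type*} [DecidableEq ι] [Fintype ι] (τ : Equiv.Perm ι) :
    ((Equiv.Perm.sign τ : ℤ) : ℝ) * ((Equiv.Perm.sign τ : ℤ) : ℝ) = 1 := by
  rcases Int.units_eq_one_or (Equiv.Perm.sign τ) with h | h <;> simp [h]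

end Signs

section Antisymmetric

variable {n k : ℕ} {f g : Comp n k}

lemma IsAnti.eq_zero (hf : IsAnti f) {v : Fin k → Fin (n + 1)} (hv : ¬ Function.Injective v) :
    f v = 0 := by
  simp only [Function.Injective, not_forall] at hv
  obtain ⟨a, b, hab, hne⟩ := hv
  have h := hf v (Equiv.swap a b)
  have hc : v ∘ Equiv.swap a b = v := by
    funext l
    simp only [Function.comp_apply, Equiv.swap_apply_def]
    split_ifs with h1 h2
    · rw [h1, hab]
    · rw [h2, hab]
    · rfl
  rw [hc, Equiv.Perm.sign_swap hne] at h
  push_cast at h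
  linarith

lemma IsAnti.epsProd_mul (hf : IsAnti f) : IsAnti fun v => epsProd n v * f v := fun v τ => by
  simp only [epsProd_comp_perm, hf v τ]; ring

lemma IsAnti.cons {f : Comp n (k + 1)} (hf : IsAnti f) (x : Fin (n + 1)) :
    IsAnti fun v : Fin k → Fin (n + 1) => f (Fin.cons x v) := fun v τ => by
  have h := hf (Fin.cons x v) (Equiv.Perm.decomposeFin.symm (0, τ))
  rw [Equiv.Perm.decomposeFin.symm_sign] at h
  simp only [if_true, one_mul] at h
  rw [← h]
  refine congrArg f (funext fun l => ?_)
  refine Fin.cases ?_ (fun l => ?_) l <;> simp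

lemma IsAnti.contract {f : Comp n (k + 1)} (hf : IsAnti f) (D : V n) :
    IsAnti (Paper.contract D f) := fun v τ => by
  simp only [Paper.contract, mul_sum]
  refine sum_congr rfl fun x _ => ?_
  linear_combination D x * hf.cons x v τ

lemma IsAnti.insertNth {f : Comp n (k + 1)} (hf : IsAnti f) (j : Fin (k + 1)) (x : Fin (n + 1))
    (v : Fin k → Fin (n + 1)) :
    f (j.insertNth x v) = (-1 : ℝ) ^ (j : ℕ) * f (Fin.cons x v) := by
  have h := hf (j.insertNth x v) j.cycleRange.symm
  rw [Fin.insertNth_comp_cycleRange_symm] at h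
  simp only [Equiv.Perm.sign_symm, Fin.sign_cycleRange] at h
  rw [h]
  push_cast
  rw [← mul_assoc, ← mul_pow]
  simp

lemma isAnti_of_alternatingMap (ω : AlternatingMap ℝ (V n) ℝ (Fin k)) :
    IsAnti fun v : Fin k → Fin (n + 1) => ω fun j => eb n (v j) := fun v τ => by
  have h := ω.map_perm (fun j => eb n (v j)) τ
  simp only [Units.smul_def, zsmul_eq_mul] at h
  exact h

/-- A sum over all multi-indices of a symmetric function vanishing on non-injective multi-indices
is `k!` times the sum over increasing multi-indices. -/
lemma sum_eq_factorial_mul_sum_strictMono [DecidablePred fun v : Fin k → Fin (n + 1) => StrictMono v]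
    (F : Comp n k) (hperm : ∀ v (τ : Equiv.Perm (Fin k)), F (v ∘ τ) = F v)
    (hinj : ∀ v, ¬ Function.Injective v → F v = 0) :
    ∑ v, F v = (k.factorial : ℝ) *
      ∑ v ∈ univ.filter (fun v : Fin k → Fin (n + 1) => StrictMono v), F v := by
  have h : ∑ p ∈ univ.filter (fun v : Fin k → Fin (n + 1) => StrictMono v) ×ˢ
      (univ : Finset (Equiv.Perm (Fin k))), F p.1 = ∑ v, F v := by
    refine sum_of_injOn (fun p => p.1 ∘ p.2) ?_ (by simp) ?_ ?_
    · rintro ⟨u, σ⟩ hu ⟨v, τ⟩ hv huv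
      simp only [coe_product, Set.mem_prod, mem_coe, mem_filter, mem_univ, true_and,
        and_true] at hu hv huv
      have hr : Set.range u = Set.range v := by
        have := congrArg Set.range huv
        rwa [σ.surjective.range_comp, τ.surjective.range_comp] at this
      obtain rfl : u = v := (StrictMono.range_inj hu hv).1 hr
      have : σ = τ := Equiv.ext fun l => hu.injective (congrFun huv l)
      rw [this]
    · intro v _ hv
      refine hinj v fun hvi => hv ?_
      refine ⟨(v ∘ Tuple.sort v, (Tuple.sort v).symm), ?_, ?_⟩
      · simpa using (Tuple.monotone_sort v).strictMono_of_injective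
          (hvi.comp (Tuple.sort v).injective)
      · funext l; simp
    · rintro ⟨u, σ⟩ _
      exact (hperm u σ).symm
  rw [← h, sum_product, mul_sum]
  refine sum_congr rfl fun v _ => ?_
  simp [Fintype.card_perm]

lemma fullInner_eq_factorial_mul [DecidablePred fun v : Fin k → Fin (n + 1) => StrictMono v]
    (hf : IsAnti f) (hg : IsAnti g) :
    fullInner f g = (k.factorial : ℝ) *
      ∑ v ∈ univ.filter (fun v : Fin k → Fin (n + 1) => StrictMono v), epsProd n v * f v * g v := by
  refine sum_eq_factorial_mul_sum_strictMono _ (fun v τ => ?_) fun v hv => ?_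
  · rw [epsProd_comp_perm, hf v τ, hg v τ]
    linear_combination (epsProd n v * f v * g v) * sign_mul_self τ
  · rw [hf.eq_zero hv]; ring

lemma fullInner_comm (f g : Comp n k) : fullInner f g = fullInner g f :=
  sum_congr rfl fun _ _ => by ring

end Antisymmetric

section Adjunction

variable {n k : ℕ}

/-- Exterior multiplication is adjoint to contraction. -/
lemma fullInner_wedgeComp (D : V n) (f : Comp n k) {g : Comp n (k + 1)} (hg : IsAnti g) :
    fullInner (wedgeComp D f) g = (k + 1) * fullInner f (contract D g) := by
  have key : ∀ j : Fin (k + 1), ∑ v : Fin (k + 1) → Fin (n + 1), epsProd n v *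
      ((-1 : ℝ) ^ (j : ℕ) * (eps n (v j) * D (v j)) * f (j.removeNth v)) * g v =
      fullInner f (contract D g) := by
    intro j
    rw [← (Fin.insertNthEquiv (fun _ => Fin (n + 1)) j).sum_comp, Fintype.sum_prod_type,
      sum_comm]
    refine sum_congr rfl fun v _ => ?_
    simp only [contract, mul_sum]
    refine sum_congr rfl fun x _ => ?_
    set u : Fin (k + 1) → Fin (n + 1) := j.insertNth x v with hu
    have hj : u j = x := by simp [hu]
    have hr : j.removeNth u = v := by simp [hu]
    have he : epsProd n u = _ := epsProd_insertNth j x v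
    have hx : g u = _ := hg.insertNth j x v
    change epsProd n u * ((-1 : ℝ) ^ (j : ℕ) * (eps n (u j) * D (u j)) * f (j.removeNth u)) *
      g u = _
    rw [hj, hr, he, hx]
    have h : ((-1 : ℝ) ^ (j : ℕ)) * (-1 : ℝ) ^ (j : ℕ) = 1 := by rw [← mul_pow]; simp
    linear_combination (epsProd n v * D x * f v * g (Fin.cons x v)) *
      (eps n x * eps n x * h + eps_mul_self n x)
  simp only [fullInner, wedgeComp, mul_sum, sum_mul]
  rw [sum_comm]
  simp only [key]
  simp [fullInner, mul_sum]

lemma contract_wedgeComp (D₁ D₂ : V n) (f : Comp n (k + 1)) (v : Fin (k + 1) → Fin (n + 1)) :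
    contract D₁ (wedgeComp D₂ f) v = mink n D₁ D₂ * f v - wedgeComp D₂ (contract D₁ f) v := by
  have hrem : ∀ (j : Fin (k + 1)) (x : Fin (n + 1)),
      (j.succ).removeNth (Fin.cons x v : Fin (k + 2) → Fin (n + 1)) =
        Fin.cons x (j.removeNth v) := by
    intro j x
    funext l
    refine Fin.cases ?_ (fun l => ?_) l <;> simp [Fin.removeNth]
  simp only [contract, wedgeComp]
  simp only [Fin.sum_univ_succ (n := k + 1), Fin.cons_zero, Fin.cons_succ, hrem, mul_add,
    sum_add_distrib]
  rw [sub_eq_add_neg]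
  congr 1
  · simp only [mink, sum_mul]
    refine sum_congr rfl fun x _ => ?_
    have : (0 : Fin (k + 2)).removeNth (Fin.cons x v : Fin (k + 2) → Fin (n + 1)) = v := by
      funext l; simp [Fin.removeNth]
    rw [this]; simp; ring
  · simp only [mul_sum]
    rw [sum_comm, ← sum_neg_distrib]
    refine sum_congr rfl fun j _ => ?_
    rw [← sum_neg_distrib]
    refine sum_congr rfl fun x _ => ?_
    rw [Fin.val_succ, pow_succ]; ring

lemma fullInner_wedgeComp_wedgeComp (D₁ D₂ : V n) {f : Comp n (k + 1)} (hf : IsAnti f)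
    (hw : IsAnti (wedgeComp D₂ f)) :
    fullInner (wedgeComp D₁ f) (wedgeComp D₂ f) = (k + 2) * (mink n D₁ D₂ * fullInner f f -
      (k + 1) * fullInner (contract D₁ f) (contract D₂ f)) := by
  rw [fullInner_wedgeComp D₁ f hw, ← fullInner_wedgeComp D₂ (contract D₁ f) hf,
    fullInner_comm (wedgeComp D₂ _) f]
  push_cast
  rw [add_assoc, one_add_one_eq_two]
  congr 1
  simp only [fullInner, mul_sum, ← sum_sub_distrib, contract_wedgeComp]
  exact sum_congr rfl fun v _ => by ring

/-- `D ↦ D* ⊗ ω` as a linear map with values in alternating forms. -/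
noncomputable def minkSmul (D : V n) (ω : AlternatingMap ℝ (V n) ℝ (Fin k)) :
    V n →ₗ[ℝ] AlternatingMap ℝ (V n) ℝ (Fin k) :=
  LinearMap.toSpanSingleton ℝ _ ω ∘ₗ
    ∑ i, (eps n i * D i) • (LinearMap.proj i : V n →ₗ[ℝ] ℝ)

lemma isAnti_wedgeComp (D : V n) (ω : AlternatingMap ℝ (V n) ℝ (Fin k)) :
    IsAnti (wedgeComp D fun v : Fin k → Fin (n + 1) => ω fun j => eb n (v j)) := by
  have h := isAnti_of_alternatingMap (AlternatingMap.alternatizeUncurryFin (minkSmul D ω))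
  convert h using 2 with v
  rw [AlternatingMap.alternatizeUncurryFin_apply]
  refine sum_congr rfl fun j _ => ?_
  simp [minkSmul, eb, Pi.single_apply, mul_assoc]
  exact Or.inl (Or.inl rfl)

end Adjunction

section Levi

variable {n k m : ℕ}

lemma levi_comp_perm (g : Fin (n + 1) → Fin (n + 1)) (τ : Equiv.Perm (Fin (n + 1))) :
    levi n (g ∘ τ) = ((Equiv.Perm.sign τ : ℤ) : ℝ) * levi n g :=
  Matrix.det_permute τ (Matrix.of fun i j => eb n (g i) j)

lemma levi_id : levi n id = 1 := by
  have : (Matrix.of fun i j => eb n (id i) j) = (1 : Matrix (Fin (n + 1)) (Fin (n + 1)) ℝ) := by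
    ext i j
    simp [eb, Matrix.one_apply, Pi.single_apply, eq_comm]
  simp only [levi, dX, this, Matrix.det_one]

lemma levi_perm (τ : Equiv.Perm (Fin (n + 1))) :
    levi n τ = ((Equiv.Perm.sign τ : ℤ) : ℝ) := by
  simpa [levi_id] using levi_comp_perm id τ

lemma isAnti_levi : IsAnti (levi n) := levi_comp_perm

lemma bijective_of_levi_ne_zero {g : Fin (n + 1) → Fin (n + 1)} (hg : levi n g ≠ 0) :
    Function.Bijective g := by
  by_contra h
  exact hg (isAnti_levi.eq_zero fun hi => h (Finite.injective_iff_bijective.1 hi))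

lemma levi_sq {g : Fin (n + 1) → Fin (n + 1)} (hg : Function.Bijective g) :
    levi n g * levi n g = 1 := by
  have h := levi_perm (Equiv.ofBijective g hg)
  rw [Equiv.coe_ofBijective] at h
  rw [h, sign_mul_self]

variable (e : Fin k ⊕ Fin m ≃ Fin (n + 1))

lemma glue_swap (i : Fin k → Fin (n + 1)) (w : Fin m → Fin (n + 1)) :
    glue ((Equiv.sumComm _ _).trans e) w i = glue e i w := by
  funext l
  simp only [glue, Function.comp_apply, Equiv.symm_trans_apply, Equiv.sumComm_symm]
  cases e.symm l <;> rfl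

lemma isAnti_levi_glue_left (w : Fin m → Fin (n + 1)) :
    IsAnti fun i : Fin k → Fin (n + 1) => levi n (glue e i w) := fun i τ => by
  have h : glue e (i ∘ τ) w =
      glue e i w ∘ ((e.symm.trans (Equiv.sumCongr τ (Equiv.refl _))).trans e) := by
    funext l
    simp only [glue, Function.comp_apply, Equiv.trans_apply, Equiv.symm_apply_apply]
    cases e.symm l <;> rfl
  simp only [h, levi_comp_perm]
  rw [Equiv.trans_assoc, ← Equiv.trans_assoc, Equiv.Perm.sign_symm_trans_trans]
  simp

lemma isAnti_levi_glue_right (i : Fin k → Fin (n + 1)) :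
    IsAnti fun w : Fin m → Fin (n + 1) => levi n (glue e i w) := by
  simpa only [glue_swap] using isAnti_levi_glue_left ((Equiv.sumComm _ _).trans e) i

lemma isAnti_starComp (f : Comp n k) : IsAnti (starComp e f) := fun w τ => by
  simp only [starComp, mul_sum]
  refine sum_congr rfl fun i _ => ?_
  linear_combination (1 / (k.factorial : ℝ)) * epsProd n i * f i * isAnti_levi_glue_right e i w τ

lemma glue_bijective {i : Fin k → Fin (n + 1)} {w : Fin m → Fin (n + 1)}
    (h : levi n (glue e i w) ≠ 0) : Function.Bijective (Sum.elim i w) := by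
  have := bijective_of_levi_ne_zero h
  rwa [glue, Function.Bijective.of_comp_iff _ e.symm.bijective] at this

lemma epsProd_mul_levi (i : Fin k → Fin (n + 1)) (w : Fin m → Fin (n + 1)) :
    epsProd n i * epsProd n w * levi n (glue e i w) = (-1 : ℝ) ^ n * levi n (glue e i w) := by
  by_cases h : levi n (glue e i w) = 0
  · simp [h]
  · have hb := (glue_bijective e h).prod_comp (eps n)
    rw [Fintype.prod_sum_type, prod_eps] at hb
    rw [← hb]; rfl

lemma sum_mul_levi_mul_levi {f : Comp n k} (hf : IsAnti f) (i₀ : Fin k → Fin (n + 1))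
    (w : Fin m → Fin (n + 1)) :
    (∑ i, f i * levi n (glue e i w)) * levi n (glue e i₀ w) =
      (k.factorial : ℝ) * f i₀ * levi n (glue e i₀ w) ^ 2 := by
  by_cases h : levi n (glue e i₀ w) = 0
  · simp [h]
  have hb := glue_bijective e h
  have hinj : Function.Injective i₀ := hb.1.comp Sum.inl_injective
  have hs : ∑ _τ : Equiv.Perm (Fin k), f i₀ * levi n (glue e i₀ w) =
      ∑ i, f i * levi n (glue e i w) := by
    refine sum_of_injOn (fun τ => i₀ ∘ τ) ?_ (by simp) ?_ ?_
    · intro σ _ τ _ hστ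
      exact Equiv.ext fun l => hinj (congrFun hστ l)
    · intro i _ hi
      by_contra hne
      have hbi := glue_bijective e (right_ne_zero_of_mul hne)
      have hii : Function.Injective i := hbi.1.comp Sum.inl_injective
      have hex : ∀ l, ∃ l', i₀ l' = i l := by
        intro l
        obtain ⟨a | b, hab⟩ := hb.2 (i l)
        · exact ⟨a, hab⟩
        · exact absurd (hbi.1 (a₁ := Sum.inr b) (a₂ := Sum.inl l) hab) (by simp)
      choose t ht using hex
      have htinj : Function.Injective t := fun a b hab => hii (by rw [← ht, ← ht, hab])
      refine hi ⟨Equiv.ofBijective t (Finite.injective_iff_bijective.1 htinj), by simp, ?_⟩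
      funext l
      simp [ht]
    · intro τ _
      have hl : levi n (glue e (i₀ ∘ τ) w) = _ := isAnti_levi_glue_left e w i₀ τ
      rw [hf i₀ τ, hl]
      linear_combination (-(f i₀ * levi n (glue e i₀ w))) * sign_mul_self τ
  rw [← hs]
  simp [Fintype.card_perm]
  ring

lemma sum_levi_sq {i : Fin k → Fin (n + 1)} (hi : Function.Injective i) :
    ∑ w, levi n (glue e i w) ^ 2 = (m.factorial : ℝ) := by
  obtain ⟨w₀, hw₀⟩ : ∃ w₀ : Fin m → Fin (n + 1), Function.Bijective (Sum.elim i w₀) := by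
    obtain ⟨g, hg⟩ := Finset.exists_equiv_extend_of_card_eq (t := (univ : Finset (Fin (n + 1))))
      (by simp [Fintype.card_congr e]) (s := univ.image (Sum.inl : Fin k → Fin k ⊕ Fin m))
      (f := Sum.elim i fun _ => 0) (by simp) (by
        rintro a ha b hb hab
        simp only [coe_image, coe_univ, Set.image_univ, Set.mem_range] at ha hb
        obtain ⟨a, rfl⟩ := ha
        obtain ⟨b, rfl⟩ := hb
        rw [hi hab])
    refine ⟨fun l => g (Sum.inr l), ?_⟩
    have : Sum.elim i (fun l => (g (Sum.inr l) : Fin (n + 1))) = fun s => (g s : Fin (n + 1)) := by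
      funext s
      rcases s with a | b
      · exact (hg (Sum.inl a) (by simp)).symm
      · rfl
    rw [this]
    refine ⟨fun a b hab => g.injective (Subtype.ext hab), fun x => ?_⟩
    exact ⟨g.symm ⟨x, mem_univ x⟩, by simp⟩
  have hsq := levi_sq (n := n) (g := glue e i w₀) (hw₀.comp e.symm.bijective)
  have h := sum_mul_levi_mul_levi ((Equiv.sumComm _ _).trans e) (isAnti_levi_glue_right e i) w₀ i
  simp only [glue_swap] at h
  simp only [sq] at h ⊢
  rw [hsq] at h
  set c := levi n (glue e i w₀)
  linear_combination c * h - (∑ w, levi n (glue e i w) * levi n (glue e i w)) * hsq +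
    (m.factorial : ℝ) * hsq

/-- The Hodge star is an isometry up to sign and normalisation. -/
lemma fullInner_starComp (f : Comp n k) {g : Comp n k} (hg : IsAnti g) :
    fullInner (starComp e f) (starComp e g) =
      (-1 : ℝ) ^ n * (m.factorial / k.factorial : ℝ) * fullInner f g := by
  have hk : (k.factorial : ℝ) ≠ 0 := by exact_mod_cast k.factorial_ne_zero
  have hstar : ∀ i w, starComp e g w * levi n (glue e i w) =
      epsProd n i * g i * levi n (glue e i w) ^ 2 := by
    intro i w
    have := sum_mul_levi_mul_levi e hg.epsProd_mul i w
    simp only [starComp]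
    rw [mul_assoc, this]
    field_simp
  have hsum : ∀ i, ∑ w, starComp e g w * levi n (glue e i w) =
      (m.factorial : ℝ) * (epsProd n i * g i) := by
    intro i
    simp only [hstar, ← mul_sum]
    by_cases hi : Function.Injective i
    · rw [sum_levi_sq e hi]; ring
    · rw [hg.eq_zero hi]; ring
  calc fullInner (starComp e f) (starComp e g)
      = ∑ w, ∑ i, (-1 : ℝ) ^ n * (1 / (k.factorial : ℝ)) * f i *
          (starComp e g w * levi n (glue e i w)) := by
        refine sum_congr rfl fun w _ => ?_
        rw [starComp, mul_sum, mul_sum, sum_mul]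
        refine sum_congr rfl fun i _ => ?_
        linear_combination (1 / (k.factorial : ℝ)) * f i * starComp e g w * epsProd_mul_levi e i w
    _ = _ := by
        rw [sum_comm]
        simp only [← mul_sum, hsum]
        rw [fullInner, mul_sum]
        refine sum_congr rfl fun i _ => ?_
        field_simp

/-- Moving the first right index to the front of the left block. -/
def sumShift (k m : ℕ) : Fin (k + 1) ⊕ Fin m ≃ Fin k ⊕ Fin (m + 1) where
  toFun := Sum.elim (Fin.cons (Sum.inr 0) Sum.inl) (fun j => Sum.inr j.succ)
  invFun := Sum.elim (fun j => Sum.inl j.succ) (Fin.cons (Sum.inl 0) Sum.inr)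
  left_inv := by
    rintro (a | b)
    · refine Fin.cases ?_ (fun a => ?_) a <;> simp
    · simp
  right_inv := by
    rintro (a | b)
    · simp
    · refine Fin.cases ?_ (fun b => ?_) b <;> simp

lemma glue_sumShift (e : Fin k ⊕ Fin (m + 1) ≃ Fin (n + 1)) (x : Fin (n + 1))
    (i : Fin k → Fin (n + 1)) (w : Fin m → Fin (n + 1)) :
    glue ((sumShift k m).trans e) (Fin.cons x i) w = glue e i (Fin.cons x w) := by
  funext l
  simp only [glue, Function.comp_apply, Equiv.symm_trans_apply]
  rcases e.symm l with a | b
  · simp [sumShift]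
  · refine Fin.cases ?_ (fun b => ?_) b <;> simp [sumShift]

lemma contract_starComp (e : Fin k ⊕ Fin (m + 1) ≃ Fin (n + 1)) (D : V n) (f : Comp n k) :
    contract D (starComp e f) = starComp ((sumShift k m).trans e) (wedgeComp D f) := by
  funext w
  have h := fullInner_wedgeComp D f (isAnti_levi_glue_left ((sumShift k m).trans e) w)
  rw [starComp]
  rw [fullInner] at h
  rw [h]
  simp only [fullInner, contract, glue_sumShift, starComp, mul_sum]
  rw [sum_comm]
  refine sum_congr rfl fun i _ => sum_congr rfl fun x _ => ?_
  rw [Nat.factorial_succ]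
  have hk : (k.factorial : ℝ) ≠ 0 := by exact_mod_cast k.factorial_ne_zero
  have hk1 : (k : ℝ) + 1 ≠ 0 := by positivity
  push_cast
  field_simp

end Levi

section Raw

variable {n k m : ℕ}

/-- The components of a raw form in the standard basis. -/
noncomputable def comp (F : (Fin k → V n) → ℝ) : Comp n k := fun v => F fun j => eb n (v j)

lemma fullInner_comp {F G : (Fin k → V n) → ℝ} (hF : IsAnti (comp F)) (hG : IsAnti (comp G)) :
    fullInner (comp F) (comp G) = (k.factorial : ℝ) * finner n k F G := by
  classical
  rw [fullInner_eq_factorial_mul hF hG, finner]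
  congr 1

/-- Linearity of a raw form in its first slot. -/
def IsLinearFirst (F : (Fin (k + 1) → V n) → ℝ) : Prop :=
  ∀ (D : V n) (v : Fin k → V n), F (Fin.cons D v) = ∑ x, D x * F (Fin.cons (eb n x) v)

lemma linearMap_eq_sum_eb (L : V n →ₗ[ℝ] ℝ) (D : V n) : L D = ∑ x, D x * L (eb n x) := by
  rw [LinearMap.pi_apply_eq_sum_univ L D]
  refine sum_congr rfl fun x _ => ?_
  rw [smul_eq_mul]
  congr 2
  funext j
  simp [eb, Pi.single_apply, eq_comm]

lemma multilinearMap_update_eq_sum_eb {ι : Type*} [DecidableEq ι]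
    (L : MultilinearMap ℝ (fun _ : ι => V n) ℝ) (u : ι → V n) (l : ι) (D : V n) :
    L (Function.update u l D) = ∑ x, D x * L (Function.update u l (eb n x)) :=
  linearMap_eq_sum_eb (L.toLinearMap u l) D

lemma isLinearFirst_alternatingMap (ω : AlternatingMap ℝ (V n) ℝ (Fin (k + 1))) :
    IsLinearFirst (ω : (Fin (k + 1) → V n) → ℝ) := fun D v => by
  have h := multilinearMap_update_eq_sum_eb ω.toMultilinearMap (Fin.cons 0 v) 0 D
  simp only [Fin.update_cons_zero] at h
  exact h

lemma comp_inter {F : (Fin (k + 1) → V n) → ℝ} (hF : IsLinearFirst F) (D : V n) :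
    comp (inter n (k + 1) D F) = contract D (comp F) := by
  funext v
  have hcons : ∀ w : Fin k → V n, inter n (k + 1) D F w = F (Fin.cons D w) := by
    intro w
    refine congrArg F (funext fun j => ?_)
    refine Fin.cases ?_ (fun j => ?_) j <;> simp
  refine (hcons _).trans ((hF D _).trans (sum_congr rfl fun x _ => ?_))
  refine congrArg (D x * F ·) (funext fun j => ?_)
  refine Fin.cases ?_ (fun j => ?_) j <;> simp

/-- The equivalence enumerating the slots of the volume form in the definition of the Hodge
star. -/
def slots (h : k + m = n + 1) : Fin k ⊕ Fin m ≃ Fin (n + 1) := finSumFinEquiv.trans (finCongr h)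

lemma reind_hodge (h : k + m = n + 1) (h' : n + 1 - k = m) (F : (Fin k → V n) → ℝ)
    (v : Fin m → V n) :
    reind n h' (hodge n k F) v = (1 / (k.factorial : ℝ)) * ∑ i : Fin k → Fin (n + 1),
      epsProd n i * comp F i * dX n (Sum.elim (fun j => eb n (i j)) v ∘ (slots h).symm) := by
  refine congrArg (_ * ·) (sum_congr rfl fun i _ => congrArg (_ * dX n ·) (funext fun l => ?_))
  obtain ⟨s, rfl⟩ := (slots h).surjective l
  rcases s with a | b
  · simp [slots]
  · simp [slots]

lemma comp_reind_hodge (h : k + m = n + 1) (h' : n + 1 - k = m) (F : (Fin k → V n) → ℝ) :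
    comp (reind n h' (hodge n k F)) = starComp (slots h) (comp F) := by
  funext w
  rw [comp, reind_hodge h, starComp]
  refine congrArg (_ * ·) (sum_congr rfl fun i _ => congrArg (_ * dX n ·) (funext fun l => ?_))
  simp only [Function.comp_apply, glue]
  cases (slots h).symm l <;> rfl

lemma isLinearFirst_reind_hodge (h : k + (m + 1) = n + 1) (h' : n + 1 - k = m + 1)
    (F : (Fin k → V n) → ℝ) : IsLinearFirst (reind n h' (hodge n k F)) := fun D v => by
  have hupd : ∀ (a : Fin k → V n) (D : V n),
      (Sum.elim a (Fin.cons D v : Fin (m + 1) → V n)) ∘ (slots h).symm =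
      Function.update (Sum.elim a (Fin.cons 0 v : Fin (m + 1) → V n) ∘ (slots h).symm)
        (slots h (Sum.inr 0)) D := by
    intro a D
    have hc : (Fin.cons D v : Fin (m + 1) → V n) =
        Function.update (Fin.cons 0 v : Fin (m + 1) → V n) 0 D := by simp
    rw [hc, ← Sum.update_elim_inr, Function.update_comp_equiv, Equiv.symm_symm]
  have hd : ∀ a : Fin k → V n,
      dX n (Sum.elim a (Fin.cons D v : Fin (m + 1) → V n) ∘ (slots h).symm) =
        ∑ x, D x * dX n (Sum.elim a (Fin.cons (eb n x) v : Fin (m + 1) → V n) ∘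
          (slots h).symm) := by
    intro a
    rw [hupd a D]
    refine (multilinearMap_update_eq_sum_eb
      (Matrix.detRowAlternating (n := Fin (n + 1)) (R := ℝ)).toMultilinearMap _ _ D).trans ?_
    refine sum_congr rfl fun x _ => ?_
    rw [hupd a (eb n x)]
    rfl
  simp only [reind_hodge h, hd, mul_sum]
  rw [sum_comm]
  exact sum_congr rfl fun x _ => sum_congr rfl fun i _ => by ring

lemma energyT_reind {p q : ℕ} (h : p = q) (F : (Fin p → V n) → ℝ) (D₁ D₂ : V n) :
    energyT n p F D₁ D₂ = energyT n q (reind n h F) D₁ D₂ := by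
  subst h; rfl

end Raw

/-- `ω` and `*ω` have the same energy tensor. -/
theorem statement14 (n k : ℕ) (hn : 1 ≤ n) (hk1 : 1 ≤ k) (hk2 : k ≤ n)
    (ω : AlternatingMap ℝ (V n) ℝ (Fin k)) (D₁ D₂ : V n) :
    energyT n (n + 1 - k) (hodge n k ⇑ω) D₁ D₂ = energyT n k ⇑ω D₁ D₂ := by
  obtain ⟨k, rfl⟩ := Nat.exists_eq_add_of_le' hk1
  obtain ⟨m, rfl⟩ := Nat.exists_eq_add_of_le hk2
  have h : (k + 1) + (m + 1) = k + 1 + m + 1 := by omega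
  have h' : k + 1 + m + 1 - (k + 1) = m + 1 := by omega
  rw [energyT_reind h']
  have hω : IsAnti (comp ⇑ω) := isAnti_of_alternatingMap ω
  have hωlin := isLinearFirst_alternatingMap ω
  have hslin := isLinearFirst_reind_hodge h h' ⇑ω
  have hsc := comp_reind_hodge h h' ⇑ω
  set S := reind (k + 1 + m) h' (hodge (k + 1 + m) (k + 1) ⇑ω)
  have hS : IsAnti (comp S) := hsc ▸ isAnti_starComp (slots h) (comp ⇑ω)
  have hw : IsAnti (wedgeComp D₂ (comp ⇑ω)) := isAnti_wedgeComp D₂ ω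
  have hi : ∀ D, IsAnti (comp (inter _ (k + 1) D ⇑ω)) := fun D => by
    rw [comp_inter hωlin]; exact hω.contract D
  have hiS : ∀ D, IsAnti (comp (inter _ (m + 1) D S)) := fun D => by
    rw [comp_inter hslin]; exact hS.contract D
  have e1 := fullInner_comp hω hω
  have e2 := fullInner_comp (hi D₁) (hi D₂)
  have e3 := fullInner_comp hS hS
  have e4 := fullInner_comp (hiS D₁) (hiS D₂)
  rw [comp_inter hωlin, comp_inter hωlin] at e2
  rw [hsc, fullInner_starComp _ _ hω, e1] at e3
  rw [comp_inter hslin, comp_inter hslin, hsc, contract_starComp, contract_starComp,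
    fullInner_starComp _ _ hw, fullInner_wedgeComp_wedgeComp D₁ D₂ hω hw, e1, e2] at e4
  simp only [Nat.add_sub_cancel] at e4
  have hk : (k.factorial : ℝ) ≠ 0 := by exact_mod_cast k.factorial_ne_zero
  have hm : (m.factorial : ℝ) ≠ 0 := by exact_mod_cast m.factorial_ne_zero
  have hk1 : (k : ℝ) + 1 ≠ 0 := by positivity
  have hk2 : (k : ℝ) + 1 + 1 ≠ 0 := by positivity
  have hm1 : (m : ℝ) + 1 ≠ 0 := by positivity
  simp only [energyT, Nat.add_sub_cancel]
  simp only [Nat.factorial_succ] at e3 e4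
  push_cast at e3 e4
  set A := finner (k + 1 + m) (k + 1) ⇑ω ⇑ω
  set F := finner (k + 1 + m) (k + 1 - 1) (inter (k + 1 + m) (k + 1) D₁ ⇑ω) (inter (k + 1 + m) (k + 1) D₂ ⇑ω)
  set B := finner (k + 1 + m) (m + 1) S S
  set G := finner (k + 1 + m) (m + 1 - 1) (inter (k + 1 + m) (m + 1) D₁ S) (inter (k + 1 + m) (m + 1) D₂ S)
  set μ := mink (k + 1 + m) D₁ D₂
  have hB : B = (-1 : ℝ) ^ (k + 1 + m) * A := by
    field_simp at e3
    linear_combination -e3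
  have hG : G = (-1 : ℝ) ^ (k + 1 + m) * (μ * A - F) := by
    rw [show (k : ℝ) + 2 = k + 1 + 1 by ring] at e4
    field_simp at e4
    linear_combination -e4
  have hpow : (-1 : ℝ) ^ m * (-1 : ℝ) ^ m = 1 := by rw [← mul_pow]; simp
  rw [hB, hG, pow_add, pow_succ]
  linear_combination (-1 : ℝ) ^ k * (F - 1 / 2 * A * μ) * hpow

end Paper
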